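/- Let N_T, N_S be integers with 1 ≤ N_S < N_T, let μ_1, μ_2 > 0 and s > 0, and let P̄_o(t) be the decentralized average outage probability function defined by P̄_o(t) = 2^{−N_S}·{ [q_1(t) + q_2(t) − q_1(t)q_2(t)] + ∑_{w=1}^{N_S} C(N_S,w)·[p_1(w,t) + p_2(w,t) − p_1(w,t)p_2(w,t)] } with q_i(t) = F_{i(N_T−N_S)}(s/t), p_i(w,t) = ∑_{ξ=N_T−N_S+1}^{N_T−w+1} [C(N_T−ξ,w−1)/C(N_S,w)] F_{i(ξ)}(s w/t), and F_{i(ξ)}(y) = ∑_{n=ξ}^{N_T} C(N_T,n)(1−e^{−y/μ_i})^n(e^{−y/μ_i})^{N_T−n}. Then lim_{t → ∞} (−ln P̄_o(t))/ln t = N_T − N_S. -/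

import Mathlib

open Filter Topology

/-- The CDF of the `ξ`-th smallest order statistic of `N_T` i.i.d. exponentials with mean `μ`. -/
noncomputable def FOrd (NT ξ : ℕ) (μ y : ℝ) : ℝ :=
  ∑ n ∈ Finset.Icc ξ NT,
    (NT.choose n : ℝ) * (1 - Real.exp (-y / μ)) ^ n * Real.exp (-y / μ) ^ (NT - n)

/-- `p_i(w,t) = ∑_{ξ=N_T−N_S+1}^{N_T−w+1} [C(N_T−ξ,w−1)/C(N_S,w)]·F_{i(ξ)}(s·w/t)`. -/
noncomputable def pW (NT NS : ℕ) (μ s t : ℝ) (w : ℕ) : ℝ :=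
  ∑ ξ ∈ Finset.Icc (NT - NS + 1) (NT - w + 1),
    ((NT - ξ).choose (w - 1) : ℝ) / (NS.choose w : ℝ) * FOrd NT ξ μ (s * w / t)

/-- The exact average outage probability (decentralized mapping scheme selection). -/
noncomputable def Pout (NT NS : ℕ) (μ₁ μ₂ s t : ℝ) : ℝ :=
  (1 / 2 ^ NS) *
    ((FOrd NT (NT - NS) μ₁ (s / t) + FOrd NT (NT - NS) μ₂ (s / t)
        - FOrd NT (NT - NS) μ₁ (s / t) * FOrd NT (NT - NS) μ₂ (s / t))
      + ∑ w ∈ Finset.Icc 1 NS, (NS.choose w : ℝ) *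
          (pW NT NS μ₁ s t w + pW NT NS μ₂ s t w
            - pW NT NS μ₁ s t w * pW NT NS μ₂ s t w))

theorem tendsto_exp_neg_div_atTop (μ a : ℝ) :
    Tendsto (fun t : ℝ => Real.exp (-(a / t) / μ)) atTop (𝓝 1) := by
  have h : Tendsto (fun t : ℝ => -(a / t) / μ) atTop (𝓝 0) := by
    simpa using ((tendsto_const_nhds (x := a)).div_atTop tendsto_id).neg.div_const μ
  simpa [Function.comp_def] using (Real.continuous_exp.tendsto 0).comp h

theorem tendsto_mul_one_sub_exp_neg_div_atTop (μ a : ℝ) :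
    Tendsto (fun t : ℝ => t * (1 - Real.exp (-(a / t) / μ))) atTop (𝓝 (a / μ)) := by
  have hd : HasDerivAt (fun x : ℝ => 1 - Real.exp (-(a * x) / μ)) (a / μ) 0 := by
    have h := (((((hasDerivAt_id (0 : ℝ)).const_mul a).neg).div_const μ).exp).const_sub 1
    simpa [neg_div] using h
  have h := hd.tendsto_slope_zero.comp
    (tendsto_inv_atTop_nhdsGT_zero.mono_right (nhdsGT_le_nhdsNE (0 : ℝ)))
  refine h.congr fun t => ?_
  simp [div_eq_mul_inv]

/-- Scaled by `t ^ d`, the CDF of an order statistic of rank at least `d` converges; only the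
term of index `d`, if present, contributes to the limit. -/
theorem tendsto_pow_mul_FOrd (NT : ℕ) {d ξ : ℕ} (hd : d ≤ ξ) (μ a : ℝ) :
    Tendsto (fun t : ℝ => t ^ d * FOrd NT ξ μ (a / t)) atTop
      (𝓝 (∑ n ∈ Finset.Icc ξ NT, (NT.choose n : ℝ) * ((a / μ) ^ d * 0 ^ (n - d)))) := by
  have he := tendsto_exp_neg_div_atTop μ a
  have hu : Tendsto (fun t : ℝ => 1 - Real.exp (-(a / t) / μ)) atTop (𝓝 0) := by
    simpa using he.const_sub 1
  simp only [FOrd, Finset.mul_sum]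
  refine tendsto_finsetSum _ fun n hn => ?_
  have hdn : d ≤ n := hd.trans (Finset.mem_Icc.1 hn).1
  have h := ((((tendsto_mul_one_sub_exp_neg_div_atTop μ a).pow d).mul
    (hu.pow (n - d))).const_mul (NT.choose n : ℝ)).mul (he.pow (NT - n))
  rw [one_pow, mul_one] at h
  refine h.congr fun t => ?_
  rw [mul_pow, mul_assoc (t ^ d), ← pow_add, Nat.add_sub_cancel' hdn]
  ring

theorem tendsto_pow_mul_FOrd_self {NT d : ℕ} (hd : d ≤ NT) (μ a : ℝ) :
    Tendsto (fun t : ℝ => t ^ d * FOrd NT d μ (a / t)) atTop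
      (𝓝 ((NT.choose d : ℝ) * (a / μ) ^ d)) := by
  have h := tendsto_pow_mul_FOrd NT le_rfl (d := d) μ a
  rwa [Finset.sum_eq_single_of_mem d (Finset.mem_Icc.2 ⟨le_rfl, hd⟩), Nat.sub_self, pow_zero,
    mul_one] at h
  intro n hn hne
  have hdn := (Finset.mem_Icc.1 hn).1
  rw [zero_pow (by omega), mul_zero, mul_zero]

theorem tendsto_pow_mul_FOrd_of_lt (NT : ℕ) {d ξ : ℕ} (hd : d < ξ) (μ a : ℝ) :
    Tendsto (fun t : ℝ => t ^ d * FOrd NT ξ μ (a / t)) atTop (𝓝 0) := by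
  have h := tendsto_pow_mul_FOrd NT hd.le μ a
  rwa [Finset.sum_eq_zero] at h
  intro n hn
  have hdn := (Finset.mem_Icc.1 hn).1
  rw [zero_pow (by omega), mul_zero, mul_zero]

theorem tendsto_pow_mul_pW (NT NS : ℕ) (μ s : ℝ) (w : ℕ) :
    Tendsto (fun t : ℝ => t ^ (NT - NS) * pW NT NS μ s t w) atTop (𝓝 0) := by
  simp only [pW, Finset.mul_sum]
  rw [← Finset.sum_const_zero (s := Finset.Icc (NT - NS + 1) (NT - w + 1))]
  refine tendsto_finsetSum _ fun ξ hξ => ?_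
  have h := (tendsto_pow_mul_FOrd_of_lt NT (Finset.mem_Icc.1 hξ).1 μ (s * w)).const_mul
    (((NT - ξ).choose (w - 1) : ℝ) / (NS.choose w : ℝ))
  rw [mul_zero] at h
  exact h.congr fun t => mul_left_comm _ _ _

/-- In the probability of a union of independent events, the product term is of lower order. -/
theorem tendsto_pow_mul_add_sub_mul {d : ℕ} (hd : d ≠ 0) {f g : ℝ → ℝ} {a b : ℝ}
    (hf : Tendsto (fun t => t ^ d * f t) atTop (𝓝 a))
    (hg : Tendsto (fun t => t ^ d * g t) atTop (𝓝 b)) :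
    Tendsto (fun t => t ^ d * (f t + g t - f t * g t)) atTop (𝓝 (a + b)) := by
  have hg0 : Tendsto g atTop (𝓝 0) := by
    refine (hg.div_atTop (tendsto_pow_atTop hd)).congr' ?_
    filter_upwards [eventually_gt_atTop 0] with t ht
    field_simp
  have h := (hf.add hg).sub (hf.mul hg0)
  rw [mul_zero, sub_zero] at h
  exact h.congr fun t => by ring

theorem tendsto_neg_log_div_log_of_tendsto_pow_mul {d : ℕ} {P : ℝ → ℝ} {C : ℝ} (hC : 0 < C)
    (hP : Tendsto (fun t => t ^ d * P t) atTop (𝓝 C)) :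
    Tendsto (fun t => -Real.log (P t) / Real.log t) atTop (𝓝 (d : ℝ)) := by
  have h := ((hP.log hC.ne').div_atTop Real.tendsto_log_atTop).const_sub (d : ℝ)
  rw [sub_zero] at h
  refine h.congr' ?_
  filter_upwards [eventually_gt_atTop 1, hP.eventually (lt_mem_nhds hC)] with t ht hpos
  have hlog : Real.log t ≠ 0 := (Real.log_pos ht).ne'
  have hPt : P t ≠ 0 := right_ne_zero_of_mul hpos.ne'
  rw [Real.log_mul (by positivity) hPt, Real.log_pow]
  field_simp
  ring

/-- The diversity order of the decentralized adaptive OFDM IM two-hop DF relay system is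
`N_T − N_S`: `lim_{t→∞} (−ln P̄_o(t))/ln t = N_T − N_S`. -/
theorem stmt_10 (NT NS : ℕ) (hNS : 1 ≤ NS) (hNT : NS < NT)
    (μ₁ μ₂ s : ℝ) (hμ₁ : 0 < μ₁) (hμ₂ : 0 < μ₂) (hs : 0 < s) :
    Tendsto (fun t : ℝ => -Real.log (Pout NT NS μ₁ μ₂ s t) / Real.log t) atTop
      (nhds ((NT - NS : ℕ) : ℝ)) := by
  have hd : NT - NS ≠ 0 := by omega
  have hF (μ : ℝ) := tendsto_pow_mul_FOrd_self (Nat.sub_le NT NS) μ s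
  have hW : Tendsto (fun t : ℝ => ∑ w ∈ Finset.Icc 1 NS, (NS.choose w : ℝ) *
      (t ^ (NT - NS) * (pW NT NS μ₁ s t w + pW NT NS μ₂ s t w
        - pW NT NS μ₁ s t w * pW NT NS μ₂ s t w))) atTop (𝓝 0) := by
    rw [← Finset.sum_const_zero (s := Finset.Icc 1 NS)]
    refine tendsto_finsetSum _ fun w _ => ?_
    simpa using (tendsto_pow_mul_add_sub_mul hd (tendsto_pow_mul_pW NT NS μ₁ s w)
      (tendsto_pow_mul_pW NT NS μ₂ s w)).const_mul (NS.choose w : ℝ)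
  have hP := (((tendsto_pow_mul_add_sub_mul hd (hF μ₁) (hF μ₂)).add hW).const_mul
    (1 / 2 ^ NS : ℝ))
  refine tendsto_neg_log_div_log_of_tendsto_pow_mul ?_ (hP.congr fun t => ?_)
  · have := Nat.choose_pos (Nat.sub_le NT NS)
    positivity
  · rw [Pout, mul_left_comm (t ^ (NT - NS)), mul_add (t ^ (NT - NS)), Finset.mul_sum]
    simp only [mul_left_comm (t ^ (NT - NS)) (NS.choose _ : ℝ)]
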